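/- Let d ≥ 2, let μ be the Haar probability measure on the unitary group U(d), and let A, B, C, D be arbitrary d×d complex matrices. Then ∫ Tr[W A W† B]·Tr[W C W† D] dμ(W) = (Tr[A]Tr[B]Tr[C]Tr[D] + Tr[AC]Tr[BD])/(d² − 1) − (Tr[AC]Tr[B]Tr[D] + Tr[A]Tr[C]Tr[BD])/(d(d² − 1)). -/

import Mathlib

open MeasureTheory Matrix
open scoped Kronecker ComplexOrder

noncomputable section

attribute [local instance] Matrix.frobeniusNormedAddCommGroup Matrix.frobeniusNormedSpace

local instance {n m : Type*} [Fintype n] [Fintype m] : MeasurableSpace (Matrix n m ℂ) :=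
  borel _

local instance {n m : Type*} [Fintype n] [Fintype m] : BorelSpace (Matrix n m ℂ) := ⟨rfl⟩

/-- The Frobenius (Hilbert–Schmidt) norm `‖M‖₂ = √Tr[M† M]`. -/
def frobNorm {n : Type*} [Fintype n] (M : Matrix n n ℂ) : ℝ :=
  Real.sqrt (Matrix.trace (star M * M)).re

/-- Entry of the conjugated matrix `W A W†`. -/
def cj {d : ℕ} (A : Matrix (Fin d) (Fin d) ℂ) (i j : Fin d)
    (W : Matrix.unitaryGroup (Fin d) ℂ) : ℂ := (W.1 * A * star W.1) i j

lemma cj_bound {d : ℕ} (A : Matrix (Fin d) (Fin d) ℂ) (i j : Fin d)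
    (W : Matrix.unitaryGroup (Fin d) ℂ) : ‖cj A i j W‖ ≤ ∑ b, ∑ a, ‖A a b‖ := by
  unfold cj
  rw [Matrix.mul_apply]
  refine (norm_sum_le _ _).trans (Finset.sum_le_sum fun b _ => ?_)
  rw [norm_mul, Matrix.mul_apply, Matrix.star_apply, norm_star]
  have h1 := entry_norm_bound_of_unitary W.2 j b
  refine (mul_le_of_le_one_right (norm_nonneg _) h1).trans ?_
  refine (norm_sum_le _ _).trans (Finset.sum_le_sum fun a _ => ?_)
  rw [norm_mul]
  exact mul_le_of_le_one_left (norm_nonneg _) (entry_norm_bound_of_unitary W.2 i a)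

lemma cj_integrable {d : ℕ} (μ : Measure (Matrix.unitaryGroup (Fin d) ℂ))
    [IsProbabilityMeasure μ] (A C : Matrix (Fin d) (Fin d) ℂ) (i j k l : Fin d) :
    Integrable (fun W => cj A i j W * cj C k l W) μ := by
  have hc : Continuous (fun W : Matrix.unitaryGroup (Fin d) ℂ => cj A i j W * cj C k l W) := by
    unfold cj; fun_prop
  refine Integrable.of_bound hc.aestronglyMeasurable
    ((∑ b, ∑ a, ‖A a b‖) * (∑ b, ∑ a, ‖C a b‖)) (Filter.Eventually.of_forall fun W => ?_)
  rw [norm_mul]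
  exact mul_le_mul (cj_bound A i j W) (cj_bound C k l W) (norm_nonneg _) ((norm_nonneg _).trans (cj_bound A i j W))

/-- The second moment tensor. -/
def tn {d : ℕ} (μ : Measure (Matrix.unitaryGroup (Fin d) ℂ))
    (A C : Matrix (Fin d) (Fin d) ℂ) (i j k l : Fin d) : ℂ :=
  ∫ W, cj A i j W * cj C k l W ∂μ

lemma cj_mul {d : ℕ} (A : Matrix (Fin d) (Fin d) ℂ) (i j : Fin d)
    (V W : Matrix.unitaryGroup (Fin d) ℂ) :
    cj A i j (V * W) = ∑ b, ∑ a, V.1 i a * star (V.1 j b) * cj A a b W := by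
  have : cj A i j (V * W) = (V.1 * (W.1 * A * star W.1) * star V.1) i j := by
    simp [cj, Matrix.mul_assoc]
  rw [this, Matrix.mul_apply]
  refine Finset.sum_congr rfl fun b _ => ?_
  rw [Matrix.mul_apply, Finset.sum_mul]
  refine Finset.sum_congr rfl fun a _ => ?_
  rw [Matrix.star_apply]; unfold cj; ring

lemma tn_inv {d : ℕ} (μ : Measure (Matrix.unitaryGroup (Fin d) ℂ))
    [μ.IsHaarMeasure] [IsProbabilityMeasure μ]
    (A C : Matrix (Fin d) (Fin d) ℂ) (V : Matrix.unitaryGroup (Fin d) ℂ) (i j k l : Fin d) :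
    tn μ A C i j k l = ∑ b, ∑ a, ∑ e, ∑ c,
      V.1 i a * star (V.1 j b) * (V.1 k c * star (V.1 l e)) * tn μ A C a b c e := by
  have h0 : tn μ A C i j k l = ∫ W, cj A i j (V * W) * cj C k l (V * W) ∂μ :=
    (integral_mul_left_eq_self (fun W => cj A i j W * cj C k l W) V).symm
  have h1 : ∀ W, cj A i j (V * W) * cj C k l (V * W) = ∑ b, ∑ a, ∑ e, ∑ c,
      V.1 i a * star (V.1 j b) * (V.1 k c * star (V.1 l e)) * (cj A a b W * cj C c e W) := by
    intro W
    rw [cj_mul, cj_mul, Finset.sum_mul]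
    refine Finset.sum_congr rfl fun b _ => ?_
    rw [Finset.sum_mul]
    refine Finset.sum_congr rfl fun a _ => ?_
    rw [Finset.mul_sum]
    refine Finset.sum_congr rfl fun e _ => ?_
    rw [Finset.mul_sum]
    refine Finset.sum_congr rfl fun c _ => ?_
    ring
  rw [h0]
  simp_rw [h1]
  have hi : ∀ a b c e, Integrable (fun W => V.1 i a * star (V.1 j b) *
      (V.1 k c * star (V.1 l e)) * (cj A a b W * cj C c e W)) μ :=
    fun a b c e => (cj_integrable μ A C a b c e).const_mul _
  rw [integral_finsetSum _ fun b _ => integrable_finsetSum _ fun a _ =>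
    integrable_finsetSum _ fun e _ => integrable_finsetSum _ fun c _ => hi a b c e]
  refine Finset.sum_congr rfl fun b _ => ?_
  rw [integral_finsetSum _ fun a _ =>
    integrable_finsetSum _ fun e _ => integrable_finsetSum _ fun c _ => hi a b c e]
  refine Finset.sum_congr rfl fun a _ => ?_
  rw [integral_finsetSum _ fun e _ => integrable_finsetSum _ fun c _ => hi a b c e]
  refine Finset.sum_congr rfl fun e _ => ?_
  rw [integral_finsetSum _ fun c _ => hi a b c e]
  refine Finset.sum_congr rfl fun c _ => ?_
  rw [integral_const_mul]; rfl

lemma tn_perm {d : ℕ} (μ : Measure (Matrix.unitaryGroup (Fin d) ℂ))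
    [μ.IsHaarMeasure] [IsProbabilityMeasure μ]
    (A C : Matrix (Fin d) (Fin d) ℂ) (σ : Equiv.Perm (Fin d)) (i j k l : Fin d) :
    tn μ A C i j k l = tn μ A C (σ i) (σ j) (σ k) (σ l) := by
  have hV : (Matrix.of fun a b => if b = σ a then (1 : ℂ) else 0) ∈
      Matrix.unitaryGroup (Fin d) ℂ := by
    rw [Matrix.mem_unitaryGroup_iff]
    ext a b
    simp [Matrix.mul_apply, Matrix.star_apply, Matrix.one_apply, apply_ite star, eq_comm]
  rw [tn_inv μ A C ⟨_, hV⟩ i j k l]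
  simp [apply_ite star, apply_ite (starRingEnd ℂ)]

lemma tn_diag {d : ℕ} (μ : Measure (Matrix.unitaryGroup (Fin d) ℂ))
    [μ.IsHaarMeasure] [IsProbabilityMeasure μ]
    (A C : Matrix (Fin d) (Fin d) ℂ) (z : Fin d → ℂ) (hz : ∀ m, z m * star (z m) = 1)
    (i j k l : Fin d) :
    tn μ A C i j k l = z i * star (z j) * (z k * star (z l)) * tn μ A C i j k l := by
  have hV : Matrix.diagonal z ∈ Matrix.unitaryGroup (Fin d) ℂ := by
    rw [Matrix.mem_unitaryGroup_iff]
    rw [Matrix.star_eq_conjTranspose, Matrix.diagonal_conjTranspose, Matrix.diagonal_mul_diagonal,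
      ← Matrix.diagonal_one]
    congr 1; ext m; exact hz m
  conv_lhs => rw [tn_inv μ A C ⟨_, hV⟩ i j k l]
  simp [Matrix.diagonal_apply, apply_ite (starRingEnd ℂ)]

lemma tn_zero {d : ℕ} (μ : Measure (Matrix.unitaryGroup (Fin d) ℂ))
    [μ.IsHaarMeasure] [IsProbabilityMeasure μ]
    (A C : Matrix (Fin d) (Fin d) ℂ) (i j k l : Fin d)
    (h : ¬ ((i = j ∧ k = l) ∨ (i = l ∧ k = j))) : tn μ A C i j k l = 0 := by
  have key : ∀ m, tn μ A C i j k l ≠ 0 →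
      (if i = m then Complex.I else 1) * star (if j = m then Complex.I else 1) *
      ((if k = m then Complex.I else 1) * star (if l = m then Complex.I else 1)) = 1 := by
    intro m hne
    have := tn_diag μ A C (fun x => if x = m then Complex.I else 1)
      (by intro x; split_ifs <;> simp) i j k l
    exact mul_right_cancel₀ hne (by rw [← this, one_mul])
  by_contra hne
  have hI : Complex.I ≠ 1 := by intro h; simpa using congrArg Complex.re h
  have hI2 : -Complex.I ≠ 1 := by intro h; simpa using congrArg Complex.re h
  have hm : (-1 : ℂ) ≠ 1 := by norm_num
  have ki := key i hne
  have kk := key k hne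
  have kj := key j hne
  have e1 : i = j ∨ i = l := by
    by_contra hc
    push Not at hc
    rw [if_neg (Ne.symm hc.1), if_neg (Ne.symm hc.2)] at ki
    split_ifs at ki <;> simp_all
  rcases e1 with e | e
  · subst e
    have : k ≠ l := fun hh => h (Or.inl ⟨rfl, hh⟩)
    by_cases hik : i = k <;> simp_all [Ne.symm this]
  · subst e
    have : k ≠ j := fun hh => h (Or.inr ⟨rfl, hh⟩)
    by_cases hik : i = k <;> simp_all [Ne.symm this]

lemma perm2 {d : ℕ} (p q i j : Fin d) (hpq : p ≠ q) (hij : i ≠ j) :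
    ∃ σ : Equiv.Perm (Fin d), σ p = i ∧ σ q = j := by
  refine ⟨Equiv.swap (Equiv.swap p i q) j * Equiv.swap p i, ?_, ?_⟩
  · have h : i ≠ Equiv.swap p i q := by
      intro h
      have : Equiv.swap p i p = Equiv.swap p i q := by rw [Equiv.swap_apply_left]; exact h
      exact hpq ((Equiv.swap p i).injective this)
    rw [Equiv.Perm.mul_apply, Equiv.swap_apply_left, Equiv.swap_apply_of_ne_of_ne h hij]
  · rw [Equiv.Perm.mul_apply, Equiv.swap_apply_left]

lemma tn_form {d : ℕ} (hd : 2 ≤ d) (μ : Measure (Matrix.unitaryGroup (Fin d) ℂ))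
    [μ.IsHaarMeasure] [IsProbabilityMeasure μ]
    (A C : Matrix (Fin d) (Fin d) ℂ) : ∃ α β : ℂ, ∀ i j k l, tn μ A C i j k l =
      α * (if i = j ∧ k = l then 1 else 0) + β * (if i = l ∧ k = j then 1 else 0) := by
  obtain ⟨p, q, hpq⟩ : ∃ p q : Fin d, p ≠ q := ⟨⟨0, by omega⟩, ⟨1, by omega⟩, by simp⟩
  set α := tn μ A C p p q q with hα
  set β := tn μ A C p q q p with hβ
  set γ := tn μ A C p p p p with hγ
  have hform : ∀ i j k l, tn μ A C i j k l =
      α * (if i = j ∧ k = l then 1 else 0) + β * (if i = l ∧ k = j then 1 else 0)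
      + (γ - α - β) * (if i = j ∧ k = l ∧ i = l then 1 else 0) := by
    intro i j k l
    by_cases h : (i = j ∧ k = l) ∨ (i = l ∧ k = j)
    · by_cases hik : i = k
      · have : i = j ∧ k = l := by
          rcases h with h | h
          · exact h
          · exact ⟨hik.trans h.2, hik.symm.trans h.1⟩
        obtain ⟨rfl, rfl⟩ := this
        subst hik
        have := tn_perm μ A C (Equiv.swap p i) p p p p
        rw [Equiv.swap_apply_left] at this
        rw [← this]; simp [← hγ]
      · obtain ⟨σ, h1, h2⟩ := perm2 p q i k hpq hik
        rcases h with ⟨rfl, rfl⟩ | ⟨rfl, rfl⟩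
        · have := tn_perm μ A C σ p p q q
          rw [h1, h2] at this
          rw [← this]; simp [← hα, hik]
        · have := tn_perm μ A C σ p q q p
          rw [h1, h2] at this
          rw [← this]; simp [← hβ, hik]
    · rw [tn_zero μ A C i j k l h]
      rw [not_or] at h
      rw [if_neg h.1, if_neg h.2, if_neg (fun hh => h.1 ⟨hh.1, hh.2.1⟩)]
      simp
  have hε : γ - α - β = 0 := by
    set s := Equiv.swap p q with hs
    set u : ℂ := (1 + Complex.I) / 2 with hu
    set v : ℂ := (1 - Complex.I) / 2 with hv
    have su : star u = v := by
      apply Complex.ext <;> simp [hu, hv]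
    have sv : star v = u := by
      apply Complex.ext <;> simp [hu, hv]
    have e1 : u * v + v * u = 1 := by
      rw [hu, hv]; ring_nf; rw [Complex.I_sq]; ring
    have e2 : u * u + v * v = 0 := by
      rw [hu, hv]; ring_nf; rw [Complex.I_sq]; ring
    have e3 : u * v = 1 / 2 := by linear_combination e1 / 2
    set P : Matrix (Fin d) (Fin d) ℂ := Matrix.of fun a b => if b = s a then (1 : ℂ) else 0 with hP
    have hPs : star P = P := by
      ext a b
      have : a = s b ↔ b = s a := by
        constructor <;> (intro h; rw [h, hs, Equiv.swap_apply_self])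
      simp [hP, Matrix.star_apply, apply_ite (starRingEnd ℂ), this]
    have hPP : P * P = 1 := by
      ext a b
      rw [Matrix.mul_apply, Finset.sum_eq_single (s a)]
      · simp [hP, Matrix.one_apply, hs, eq_comm]
      · intro c _ hc
        simp [hP, hc]
      · simp
    have hV : u • (1 : Matrix (Fin d) (Fin d) ℂ) + v • P ∈ Matrix.unitaryGroup (Fin d) ℂ := by
      rw [Matrix.mem_unitaryGroup_iff, star_add, star_smul, star_smul, star_one, hPs, su, sv]
      simp only [add_mul, mul_add, smul_mul_smul_comm, one_mul, mul_one, hPP]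
      calc _ = (u * v + v * u) • (1 : Matrix (Fin d) (Fin d) ℂ) + (u * u + v * v) • P := by
            module
        _ = 1 := by rw [e1, e2]; simp
    set w : Fin d → ℂ := fun a => (if a = p then u else 0) + (if a = q then v else 0) with hw
    have hVp : ∀ a, (u • (1 : Matrix (Fin d) (Fin d) ℂ) + v • P) p a = w a := by
      intro a
      simp [hP, hw, hs, Matrix.one_apply, eq_comm]
    have hinv := tn_inv μ A C ⟨_, hV⟩ p p p p
    simp only [hVp] at hinv
    have hww : ∀ a, w a * star (w a) = (1 / 2) * ((if a = p then 1 else 0) + (if a = q then 1 else 0)) := by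
      intro a
      by_cases h1 : a = p
      · subst h1
        simp only [hw, if_pos, if_neg hpq, add_zero, su, e3]; ring
      · by_cases h2 : a = q
        · subst h2
          simp only [hw, if_pos, if_neg hpq.symm, add_zero, zero_add, sv]
          rw [mul_comm, e3]; ring
        · simp [hw, h1, h2]
    have hn : ∑ a, w a * star (w a) = 1 := by
      simp_rw [hww]
      rw [← Finset.mul_sum, Finset.sum_add_distrib]; simp; norm_num
    have hn2 : ∑ a, (w a * star (w a)) * (w a * star (w a)) = 1 / 2 := by
      have : ∀ a, (w a * star (w a)) * (w a * star (w a)) = (1 / 4) * ((if a = p then 1 else 0) + (if a = q then 1 else 0)) := by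
        intro a
        rw [hww]
        by_cases h1 : a = p
        · subst h1
          simp [hpq]; norm_num
        · by_cases h2 : a = q
          · subst h2
            simp [h1]; norm_num
          · simp [h1, h2]
      simp_rw [this]
      rw [← Finset.mul_sum, Finset.sum_add_distrib]; simp; norm_num
    have hsum : (∑ b, ∑ a, ∑ e, ∑ c, w a * star (w b) * (w c * star (w e)) * tn μ A C a b c e)
        = α * ((∑ a, w a * star (w a)) * (∑ a, w a * star (w a)))
         + β * ((∑ a, w a * star (w a)) * (∑ a, w a * star (w a)))
         + (γ - α - β) * ∑ a, (w a * star (w a)) * (w a * star (w a)) := by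
      simp_rw [hform, mul_add, Finset.sum_add_distrib]
      congr 1
      · congr 1
        · rw [Finset.sum_mul_sum]
          simp only [Finset.mul_sum, ite_and]
          refine Finset.sum_congr rfl fun b _ => ?_
          simp
          refine Finset.sum_congr rfl fun e _ => ?_
          ring
        · rw [Finset.sum_mul_sum]
          simp only [Finset.mul_sum, ite_and]
          refine Finset.sum_congr rfl fun b _ => ?_
          simp
          refine Finset.sum_congr rfl fun e _ => ?_
          ring
      · simp only [Finset.mul_sum, ite_and]
        refine Finset.sum_congr rfl fun b _ => ?_
        simp
        ring
    rw [hsum, hn, hn2, ← hγ] at hinv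
    linear_combination 2 * hinv
  refine ⟨α, β, fun i j k l => ?_⟩
  rw [hform, hε]; ring

lemma tr_conj {d : ℕ} (A : Matrix (Fin d) (Fin d) ℂ) (W : Matrix.unitaryGroup (Fin d) ℂ) :
    ∑ i, cj A i i W = A.trace := by
  have : ∑ i, cj A i i W = (W.1 * A * star W.1).trace := rfl
  rw [this, Matrix.trace_mul_comm, ← Matrix.mul_assoc, Unitary.coe_star_mul_self, Matrix.one_mul]

lemma tr_conj2 {d : ℕ} (A C : Matrix (Fin d) (Fin d) ℂ) (W : Matrix.unitaryGroup (Fin d) ℂ) :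
    ∑ i, ∑ j, cj A i j W * cj C j i W = (A * C).trace := by
  have : ∑ i, ∑ j, cj A i j W * cj C j i W =
    ((W.1 * A * star W.1) * (W.1 * C * star W.1)).trace := by
    simp [Matrix.trace, Matrix.mul_apply (M := W.1 * A * star W.1), cj]
  rw [this]
  have : (W.1 * A * star W.1) * (W.1 * C * star W.1) = W.1 * (A * C) * star W.1 := by
    calc _ = W.1 * A * (star W.1 * W.1) * C * star W.1 := by simp only [Matrix.mul_assoc]
      _ = _ := by rw [Unitary.coe_star_mul_self, Matrix.mul_one]; simp only [Matrix.mul_assoc]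
  rw [this, Matrix.trace_mul_comm, ← Matrix.mul_assoc, Unitary.coe_star_mul_self, Matrix.one_mul]

/-- Lemma 2 (second-moment Weingarten formula): for the Haar probability measure on `U(d)`
with `d ≥ 2` and arbitrary `d × d` complex matrices `A, B, C, D`,
`∫ Tr[W A W† B]·Tr[W C W† D] dμ(W)
  = (Tr[A]Tr[B]Tr[C]Tr[D] + Tr[AC]Tr[BD])/(d² − 1)
    − (Tr[AC]Tr[B]Tr[D] + Tr[A]Tr[C]Tr[BD])/(d(d² − 1))`. -/
theorem haar_second_moment_trace (d : ℕ) (hd : 2 ≤ d)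
    (μ : Measure (Matrix.unitaryGroup (Fin d) ℂ))
    [μ.IsHaarMeasure] [IsProbabilityMeasure μ]
    (A B C D : Matrix (Fin d) (Fin d) ℂ) :
    ∫ W : Matrix.unitaryGroup (Fin d) ℂ,
        (W.1 * A * star W.1 * B).trace * (W.1 * C * star W.1 * D).trace ∂μ
      = (A.trace * B.trace * C.trace * D.trace + (A * C).trace * (B * D).trace)
          / ((d : ℂ) ^ 2 - 1)
        - ((A * C).trace * B.trace * D.trace + A.trace * C.trace * (B * D).trace)
          / ((d : ℂ) * ((d : ℂ) ^ 2 - 1)) := by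
  obtain ⟨α, β, h⟩ := tn_form hd μ A C
  have h1 : A.trace * C.trace = α * (d : ℂ) ^ 2 + β * d := by
    have e : ∑ i, ∑ k, tn μ A C i i k k = A.trace * C.trace := by
      unfold tn
      simp_rw [← integral_finsetSum _ fun k _ => cj_integrable μ A C _ _ k k]
      rw [← integral_finsetSum _ fun i _ => integrable_finsetSum _ fun k _ =>
        cj_integrable μ A C i i k k]
      simp_rw [← Finset.sum_mul_sum, tr_conj]
      simp
    rw [← e]
    simp_rw [h]
    simp [Finset.sum_add_distrib, ite_and]
    ring
  have h2 : (A * C).trace = α * d + β * (d : ℂ) ^ 2 := by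
    have e : ∑ i, ∑ k, tn μ A C i k k i = (A * C).trace := by
      unfold tn
      simp_rw [← integral_finsetSum _ fun k _ => cj_integrable μ A C _ k k _]
      rw [← integral_finsetSum _ fun i _ => integrable_finsetSum _ fun k _ =>
        cj_integrable μ A C i k k i]
      simp_rw [tr_conj2]
      simp
    rw [← e]
    simp_rw [h]
    simp [Finset.sum_add_distrib, ite_and]
    ring
  have h3 : ∫ W : Matrix.unitaryGroup (Fin d) ℂ,
        (W.1 * A * star W.1 * B).trace * (W.1 * C * star W.1 * D).trace ∂μ
      = α * (B.trace * D.trace) + β * (B * D).trace := by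
    have e : ∀ W : Matrix.unitaryGroup (Fin d) ℂ,
        (W.1 * A * star W.1 * B).trace * (W.1 * C * star W.1 * D).trace =
        ∑ i, ∑ k, ∑ j, ∑ l, (B j i * D l k) * (cj A i j W * cj C k l W) := by
      intro W
      have t : ∀ X B : Matrix (Fin d) (Fin d) ℂ, (X * B).trace = ∑ i, ∑ j, X i j * B j i := by
        intro X B; simp [Matrix.trace, Matrix.mul_apply]
      rw [t, t, Finset.sum_mul_sum]
      refine Finset.sum_congr rfl fun i _ => Finset.sum_congr rfl fun k _ => ?_
      rw [Finset.sum_mul_sum]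
      refine Finset.sum_congr rfl fun j _ => Finset.sum_congr rfl fun l _ => ?_
      unfold cj; ring
    simp_rw [e]
    have hi : ∀ i j k l, Integrable (fun W => (B j i * D l k) * (cj A i j W * cj C k l W)) μ :=
      fun i j k l => (cj_integrable μ A C i j k l).const_mul _
    have e2 : (∫ W, ∑ i, ∑ k, ∑ j, ∑ l, (B j i * D l k) * (cj A i j W * cj C k l W) ∂μ)
        = ∑ i, ∑ k, ∑ j, ∑ l, (B j i * D l k) * tn μ A C i j k l := by
      rw [integral_finsetSum _ fun i _ => integrable_finsetSum _ fun k _ =>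
        integrable_finsetSum _ fun j _ => integrable_finsetSum _ fun l _ => hi i j k l]
      refine Finset.sum_congr rfl fun i _ => ?_
      rw [integral_finsetSum _ fun k _ =>
        integrable_finsetSum _ fun j _ => integrable_finsetSum _ fun l _ => hi i j k l]
      refine Finset.sum_congr rfl fun k _ => ?_
      rw [integral_finsetSum _ fun j _ => integrable_finsetSum _ fun l _ => hi i j k l]
      refine Finset.sum_congr rfl fun j _ => ?_
      rw [integral_finsetSum _ fun l _ => hi i j k l]
      refine Finset.sum_congr rfl fun l _ => ?_
      rw [integral_const_mul]; rfl
    rw [e2]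
    simp_rw [h, mul_add, Finset.sum_add_distrib]
    congr 1
    · simp only [Matrix.trace, Matrix.diag]
      rw [Finset.sum_mul_sum]
      simp only [Finset.mul_sum, ite_and]
      refine Finset.sum_congr rfl fun i _ => Finset.sum_congr rfl fun k _ => ?_
      simp
      ring
    · have : (B * D).trace = ∑ i, ∑ k, B k i * D i k := by
        rw [Matrix.trace_mul_comm]
        simp [Matrix.trace, Matrix.mul_apply, mul_comm]
      rw [this]
      simp only [Finset.mul_sum, ite_and]
      refine Finset.sum_congr rfl fun i _ => Finset.sum_congr rfl fun k _ => ?_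
      simp
      ring
  rw [h3]
  have hd0 : (d : ℂ) ≠ 0 := by
    have : d ≠ 0 := by omega
    exact_mod_cast this
  have hd1 : (d : ℂ) ^ 2 - 1 ≠ 0 := by
    intro hh
    have h4 : ((d ^ 2 : ℕ) : ℂ) = ((1 : ℕ) : ℂ) := by push_cast; linear_combination hh
    have h5 : d ^ 2 = 1 := by exact_mod_cast h4
    nlinarith
  have h1' : A.trace * B.trace * C.trace * D.trace = (α * (d : ℂ) ^ 2 + β * d) * (B.trace * D.trace) := by
    rw [← h1]; ring
  rw [h1', h1, h2]
  field_simp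
  ring
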